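/- For every pair of integers x, y with 0 ≤ x < y < u, it holds that |enc(x) ⊕ enc(y)| = Σ_{k=1}^{log₂ u} max_{x ≤ j < y} c^{(k)}_j. -/

import Mathlib

/-- Length of the longest common prefix of two bit-strings. -/
def lcpLen : List Bool → List Bool → ℕ
  | a :: as, b :: bs => if a = b then lcpLen as bs + 1 else 0
  | _, _ => 0

/-- `|α ⊕ β|`: the length of `β` minus the length of the longest common
prefix of `α` and `β`. -/
def oplusLen (α β : List Bool) : ℕ := β.length - lcpLen α β

/-- `enc(x)`: the standard binary representation of `x` using exactly `L = log₂ u`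
bits (most significant bit first). -/
def encBits (L x : ℕ) : List Bool := (List.range L).map fun i => x.testBit (L - 1 - i)

/-- `c^{(k)}_j`: 1 if `j+1` is a multiple of `2^{k-1}`, and 0 otherwise. -/
def cK (k j : ℕ) : ℕ := if 2 ^ (k - 1) ∣ (j + 1) then 1 else 0

theorem lcpLen_le : ∀ α β : List Bool, lcpLen α β ≤ β.length
  | [], _ => by simp [lcpLen]
  | _ :: _, [] => by simp [lcpLen]
  | a :: as, b :: bs => by
    have := lcpLen_le as bs
    simp only [lcpLen, List.length_cons]
    split_ifs <;> omega

theorem oplusLen_cons (a b : Bool) (α β : List Bool) :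
    oplusLen (a :: α) (b :: β) = if a = b then oplusLen α β else β.length + 1 := by
  simp only [oplusLen, lcpLen, List.length_cons]
  split_ifs <;> omega

theorem oplusLen_append_singleton (a b : Bool) :
    ∀ α β : List Bool, α.length = β.length →
      oplusLen (α ++ [a]) (β ++ [b]) =
        if α ++ [a] = β ++ [b] then 0 else oplusLen α β + 1
  | [], [], _ => by cases a <;> cases b <;> rfl
  | a' :: α, b' :: β, h => by
    have ih := oplusLen_append_singleton a b α β (by simpa using h)
    by_cases hab : a' = b' <;> simp_all [oplusLen_cons]
  | [], _ :: _, h => by simp at h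
  | _ :: _, [], h => by simp at h

theorem length_encBits (L x : ℕ) : (encBits L x).length = L := by
  simp [encBits]

theorem encBits_succ (L x : ℕ) :
    encBits (L + 1) x = encBits L (x / 2) ++ [x.testBit 0] := by
  simp only [encBits, List.range_succ, List.map_append, List.map_cons, List.map_nil]
  congr 1
  · refine List.map_congr_left fun i hi => ?_
    rw [List.mem_range] at hi
    rw [← Nat.testBit_succ]
    congr 1
    omega
  · simp

theorem encBits_inj {L x y : ℕ} (hx : x < 2 ^ L) (hy : y < 2 ^ L) :
    encBits L x = encBits L y ↔ x = y := by
  refine ⟨fun h => ?_, fun h => h ▸ rfl⟩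
  induction L generalizing x y with
  | zero => simp_all
  | succ L ih =>
    rw [encBits_succ, encBits_succ, List.append_singleton_inj] at h
    have hdiv := ih (x := x / 2) (y := y / 2) (by omega) (by omega) h.1
    have hmod := h.2
    simp only [Nat.testBit_zero, decide_eq_decide] at hmod
    omega

theorem oplusLen_encBits {L x y : ℕ} (hx : x < 2 ^ L) (hy : y < 2 ^ L) :
    oplusLen (encBits L x) (encBits L y) =
      ∑ i ∈ Finset.range L, if x / 2 ^ i = y / 2 ^ i then 0 else 1 := by
  induction L generalizing x y with
  | zero => simp [oplusLen, encBits]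
  | succ L ih =>
    have key := oplusLen_append_singleton (x.testBit 0) (y.testBit 0)
      (encBits L (x / 2)) (encBits L (y / 2)) (by simp only [length_encBits])
    rw [← encBits_succ, ← encBits_succ] at key
    rw [key, Finset.sum_range_succ', ih (x := x / 2) (y := y / 2) (by omega) (by omega)]
    by_cases hxy : x = y
    · simp [hxy]
    · simp [encBits_inj hx hy, hxy, Nat.div_div_eq_div_mul, pow_succ']

theorem sup_cK_succ {x y : ℕ} (hxy : x ≤ y) (i : ℕ) :
    ((Finset.Ico x y).sup fun j => cK (i + 1) j) =
      if x / 2 ^ i = y / 2 ^ i then 0 else 1 := by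
  have hpos : 0 < 2 ^ i := by positivity
  split_ifs with h
  · refine Nat.le_zero.mp (Finset.sup_le fun j hj => ?_)
    rw [Finset.mem_Ico] at hj
    have hdvd : ¬ 2 ^ i ∣ j + 1 := by
      rintro ⟨m, hm⟩
      have h₁ : x / 2 ^ i < m := (Nat.div_lt_iff_lt_mul hpos).mpr (by rw [mul_comm]; omega)
      have h₂ : m ≤ y / 2 ^ i := (Nat.le_div_iff_mul_le hpos).mpr (by rw [mul_comm]; omega)
      omega
    simp [cK, hdvd]
  · refine le_antisymm (Finset.sup_le fun j _ => ?_) ?_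
    · simp only [cK]
      split_ifs <;> simp
    · have hlt : x / 2 ^ i < y / 2 ^ i := lt_of_le_of_ne (Nat.div_le_div_right hxy) h
      have h₁ : x < y / 2 ^ i * 2 ^ i := (Nat.div_lt_iff_lt_mul hpos).mp hlt
      have h₂ : y / 2 ^ i * 2 ^ i ≤ y := Nat.div_mul_le_self _ _
      have hmem : y / 2 ^ i * 2 ^ i - 1 ∈ Finset.Ico x y := by
        rw [Finset.mem_Ico]
        omega
      refine le_trans (le_of_eq ?_) (Finset.le_sup hmem)
      rw [cK, if_pos]
      rw [Nat.sub_add_cancel (by omega)]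
      exact dvd_mul_left _ _

/-- for `0 ≤ x < y < u = 2^L`,
`|enc(x) ⊕ enc(y)| = Σ_{k=1}^{log₂ u} max_{x ≤ j < y} c^{(k)}_j`. -/
theorem stmt4 (L x y : ℕ) (hxy : x < y) (hy : y < 2 ^ L) :
    oplusLen (encBits L x) (encBits L y) =
      ∑ k ∈ Finset.Icc 1 L, (Finset.Ico x y).sup fun j => cK k j := by
  rw [oplusLen_encBits (hxy.trans hy) hy, Finset.range_eq_Ico,
    ← Finset.Ico_add_one_right_eq_Icc, ← Finset.sum_Ico_add' _ 0 L 1]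
  exact Finset.sum_congr rfl fun i _ => (sup_cK_succ hxy.le i).symm
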